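/- For every irrational number ρ ∈ [0,1) there exist a C^∞, non-decreasing, degree-one circle map f with rotation number ρ which is constant on an arc U of positive length, an arc I ⊂ S¹ of positive length, and a non-empty closed set Q ⊂ S¹ with f(Q) = Q, such that: (i) ω(x) = Q for every x ∈ I (so the realm of attraction of Q has positive Lebesgue measure); (ii) Q is infinite (it is not a periodic orbit); and (iii) no proper closed subset Q′ ⊊ Q satisfies ω(x) ⊆ Q′ for all x ∈ I. In other words, Q is an attractor for f whose basin contains an interval. -/

import Mathlib

open Filter Topology Set

/-- The ω-limit set of a point `x` under a map `f` of the circle: the set of cluster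
points of the forward orbit `(f^[n] x)`. -/
def omegaLimitSet (f : AddCircle (1:ℝ) → AddCircle (1:ℝ)) (x : AddCircle (1:ℝ)) :
    Set (AddCircle (1:ℝ)) :=
  {z | MapClusterPt z atTop fun n : ℕ => f^[n] x}

namespace CircleDeg1Lift

/-- The translation number depends continuously on the map: the continuous functions
`(f t ^ n) 0 / n` converge to it uniformly in `t`. -/
theorem continuous_translationNumber {X : Type*} [TopologicalSpace X] {f : X → CircleDeg1Lift}
    (hf : Continuous fun p : X × ℝ => f p.1 p.2) :
    Continuous fun t => (f t).translationNumber := by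
  have hiter : ∀ n : ℕ, Continuous fun t => (f t ^ n) 0 := by
    intro n
    induction n with
    | zero => simpa using continuous_const
    | succ n ih =>
      have : (fun t => (f t ^ (n + 1)) 0) = fun t => f t ((f t ^ n) 0) := by
        funext t
        rw [pow_succ', mul_apply]
      rw [this]
      exact hf.comp (continuous_id.prodMk ih)
  have hunif : TendstoUniformly (fun (n : ℕ) t => (f t ^ (n + 1)) 0 / ((n : ℝ) + 1))
      (fun t => (f t).translationNumber) atTop := by
    rw [Metric.tendstoUniformly_iff]
    intro ε hε
    filter_upwards [(tendsto_one_div_add_atTop_nhds_zero_nat (𝕜 := ℝ)).eventually_lt_const hε]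
      with n hn t
    refine lt_of_le_of_lt ?_ hn
    have h := (f t).dist_pow_map_zero_mul_translationNumber_le (n + 1)
    have hpos : (0 : ℝ) < (n : ℝ) + 1 := by positivity
    rw [Real.dist_eq, abs_sub_comm] at h
    push_cast at h
    rw [Real.dist_eq]
    rw [le_div_iff₀ hpos, ← abs_of_pos hpos, ← abs_mul, abs_of_pos hpos, sub_mul,
      div_mul_cancel₀ _ hpos.ne', mul_comm]
    exact h
  exact hunif.continuous (Frequently.of_forall fun n => (hiter (n + 1)).div_const _)

theorem tendsto_iterate_div (f : CircleDeg1Lift) (x : ℝ) :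
    Tendsto (fun n : ℕ => f^[n] x / n) atTop (𝓝 f.translationNumber) := by
  have h := (f.tendsto_translationNumber x).add
    (tendsto_const_div_atTop_nhds_zero_nat x)
  simpa [← add_div, coe_pow] using h

theorem iterate_map_add_int (f : CircleDeg1Lift) (n : ℕ) (x : ℝ) (m : ℤ) :
    f^[n] (x + m) = f^[n] x + m := by
  rw [← coe_pow, map_add_int]

/-- If the translation number is positive, then every orbit, up to an integer translation,
meets the interval between a point and its image. -/
theorem exists_iterate_add_int_mem_Icc {f : CircleDeg1Lift} (hf : 0 < f.translationNumber)
    (a y : ℝ) : ∃ (k : ℕ) (m : ℤ), f^[k] y + m ∈ Icc a (f a) := by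
  obtain ⟨m, hm⟩ : ∃ m : ℤ, y + m < a := by
    obtain ⟨m, hm⟩ := exists_int_lt (a - y)
    exact ⟨m, by linarith⟩
  have htop : Tendsto (fun n : ℕ => f^[n] (y + m)) atTop atTop := by
    have h := (f.tendsto_iterate_div (y + m)).pos_mul_atTop hf
      (tendsto_natCast_atTop_atTop (R := ℝ))
    refine h.congr' ?_
    filter_upwards [eventually_ne_atTop 0] with n hn
    field_simp
  have hex : ∃ k : ℕ, a ≤ f^[k] (y + m) := (htop.eventually_ge_atTop a).exists
  classical
  obtain ⟨k, hk⟩ : ∃ k, Nat.find hex = k + 1 := by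
    refine Nat.exists_eq_succ_of_ne_zero fun h0 => ?_
    have := Nat.find_spec hex
    rw [h0] at this
    exact absurd this (not_le.2 hm)
  have hlt : f^[k] (y + m) < a := not_le.1 (Nat.find_min hex (by omega))
  have hge := Nat.find_spec hex
  rw [hk] at hge
  refine ⟨k + 1, m, ?_⟩
  rw [← iterate_map_add_int]
  refine ⟨hge, ?_⟩
  rw [Function.iterate_succ_apply']
  exact f.mono hlt.le

/-- If the translation number is negative, then every orbit, up to an integer translation,
meets the interval between a point and its image. -/
theorem exists_iterate_add_int_mem_Icc' {f : CircleDeg1Lift} (hf : f.translationNumber < 0)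
    (a y : ℝ) : ∃ (k : ℕ) (m : ℤ), f^[k] y + m ∈ Icc (f a) a := by
  obtain ⟨m, hm⟩ : ∃ m : ℤ, a < y + m := by
    obtain ⟨m, hm⟩ := exists_int_gt (a - y)
    exact ⟨m, by linarith⟩
  have hbot : Tendsto (fun n : ℕ => f^[n] (y + m)) atTop atBot := by
    have h := (f.tendsto_iterate_div (y + m)).neg_mul_atTop hf
      (tendsto_natCast_atTop_atTop (R := ℝ))
    refine h.congr' ?_
    filter_upwards [eventually_ne_atTop 0] with n hn
    field_simp
  have hex : ∃ k : ℕ, f^[k] (y + m) ≤ a := (hbot.eventually_le_atBot a).exists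
  classical
  obtain ⟨k, hk⟩ : ∃ k, Nat.find hex = k + 1 := by
    refine Nat.exists_eq_succ_of_ne_zero fun h0 => ?_
    have := Nat.find_spec hex
    rw [h0] at this
    exact absurd this (not_le.2 hm)
  have hlt : a < f^[k] (y + m) := not_le.1 (Nat.find_min hex (by omega))
  have hge := Nat.find_spec hex
  rw [hk] at hge
  refine ⟨k + 1, m, ?_⟩
  rw [← iterate_map_add_int]
  refine ⟨?_, hge⟩
  rw [Function.iterate_succ_apply']
  exact f.mono hlt.le

/-- For an irrational translation number, every orbit meets, up to an integer translation,
any interval whose endpoints lie in one orbit modulo the integers. -/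
theorem exists_iterate_add_int_mem_uIcc {f : CircleDeg1Lift}
    (hf : Irrational f.translationNumber) {n : ℕ} (hn : n ≠ 0) (p : ℤ) (a y : ℝ) :
    ∃ (k : ℕ) (m : ℤ), f^[k] y + m ∈ uIcc a (f^[n] a + p) := by
  set g : CircleDeg1Lift := translate (Multiplicative.ofAdd (p : ℝ)) * f ^ n with hg
  have hgx : ∀ x, g x = f^[n] x + p := fun x => by
    rw [hg, mul_apply, translate_apply, coe_pow, add_comm]
  have hgk : ∀ (k : ℕ) x, g^[k] x = f^[n * k] x + (k * p : ℤ) := by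
    intro k x
    induction k with
    | zero => simp
    | succ k ih =>
      rw [Function.iterate_succ_apply', ih, hgx, iterate_map_add_int, Nat.mul_succ,
        Nat.add_comm, Function.iterate_add_apply]
      push_cast
      ring
  have hτ : g.translationNumber = p + n * f.translationNumber := by
    rw [hg, translationNumber_mul_of_commute, translationNumber_translate, translationNumber_pow]
    rw [commute_iff_commute]
    intro x
    simp
  have hne : g.translationNumber ≠ 0 := by
    rw [hτ]
    exact ((hf.natCast_mul hn).intCast_add p).ne_zero
  obtain ⟨k, m, hkm⟩ : ∃ (k : ℕ) (m : ℤ), g^[k] y + m ∈ uIcc a (g a) := by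
    rcases hne.lt_or_gt with h | h
    · obtain ⟨k, m, hkm⟩ := exists_iterate_add_int_mem_Icc' h a y
      exact ⟨k, m, Icc_subset_uIcc' hkm⟩
    · obtain ⟨k, m, hkm⟩ := exists_iterate_add_int_mem_Icc h a y
      exact ⟨k, m, Icc_subset_uIcc hkm⟩
  refine ⟨n * k, k * p + m, ?_⟩
  rw [hgk, hgx, add_assoc] at hkm
  exact_mod_cast hkm

end CircleDeg1Lift

theorem AddCircle.exists_eq_add_int_of_coe_eq {x y : ℝ}
    (h : (x : AddCircle (1:ℝ)) = (y : AddCircle (1:ℝ))) : ∃ m : ℤ, x = y + m := by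
  have h0 : ((x - y : ℝ) : AddCircle (1:ℝ)) = 0 := by
    rw [AddCircle.coe_sub, h, sub_self]
  obtain ⟨m, hm⟩ := AddCircle.coe_eq_zero_iff (1:ℝ) |>.1 h0
  refine ⟨m, ?_⟩
  simp only [zsmul_eq_mul, mul_one] at hm
  linarith

theorem AddCircle.coe_add_int (x : ℝ) (m : ℤ) :
    ((x + m : ℝ) : AddCircle (1:ℝ)) = (x : AddCircle (1:ℝ)) := by
  have h : ((m : ℝ) : AddCircle (1:ℝ)) = 0 :=
    (AddCircle.coe_eq_zero_iff (1:ℝ)).2 ⟨m, by simp⟩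
  rw [AddCircle.coe_add, h, add_zero]

section Lift

variable {F : CircleDeg1Lift} {f : AddCircle (1:ℝ) → AddCircle (1:ℝ)}

theorem iterate_coe_eq (hF : ∀ x : ℝ, f (x : AddCircle (1:ℝ)) = ((F x : ℝ) : AddCircle (1:ℝ)))
    (n : ℕ) (x : ℝ) : f^[n] (x : AddCircle (1:ℝ)) = ((F^[n] x : ℝ) : AddCircle (1:ℝ)) := by
  have h : Function.Semiconj (fun r : ℝ => (r : AddCircle (1:ℝ))) F f := fun r => (hF r).symm
  exact ((h.iterate_right n) x).symm

theorem omegaLimitSet_subset_of_irrational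
    (hF : ∀ x : ℝ, f (x : AddCircle (1:ℝ)) = ((F x : ℝ) : AddCircle (1:ℝ)))
    (hτ : Irrational F.translationNumber) (x y : AddCircle (1:ℝ)) :
    omegaLimitSet f x ⊆ omegaLimitSet f y := by
  intro z hz
  induction x using QuotientAddGroup.induction_on with | H x => ?_
  induction y using QuotientAddGroup.induction_on with | H y => ?_
  induction z using QuotientAddGroup.induction_on with | H z => ?_
  simp only [omegaLimitSet, mem_ofPred_eq, mapClusterPt_iff_frequently] at hz ⊢
  intro s hs
  obtain ⟨ε, hε, hball⟩ := Metric.mem_nhds_iff.1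
    ((AddCircle.continuous_mk' (1:ℝ)).continuousAt (x := z) hs)
  have hnhds : (fun r : ℝ => (r : AddCircle (1:ℝ))) '' Metric.ball z ε ∈
      𝓝 (z : AddCircle (1:ℝ)) :=
    (QuotientAddGroup.isOpenMap_coe (N := AddSubgroup.zmultiples (1:ℝ))).image_mem_nhds
      (Metric.ball_mem_nhds z hε)
  have hfreq := frequently_atTop.1 (hz _ hnhds)
  obtain ⟨n₁, -, r₁, hr₁, he₁⟩ := hfreq 0
  obtain ⟨n₂, hn, r₂, hr₂, he₂⟩ := hfreq (n₁ + 1)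
  simp only [iterate_coe_eq hF] at he₁ he₂
  obtain ⟨p₁, hp₁⟩ := AddCircle.exists_eq_add_int_of_coe_eq he₁
  obtain ⟨p₂, hp₂⟩ := AddCircle.exists_eq_add_int_of_coe_eq he₂
  have hr : r₂ = F^[n₂ - n₁] r₁ + (p₂ - p₁ : ℤ) := by
    rw [hp₁, hp₂, CircleDeg1Lift.iterate_map_add_int, ← Function.iterate_add_apply,
      Nat.sub_add_cancel (by omega)]
    push_cast
    ring
  rw [frequently_atTop]
  intro N
  obtain ⟨k, m, hkm⟩ := CircleDeg1Lift.exists_iterate_add_int_mem_uIcc hτ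
    (n := n₂ - n₁) (by omega) (p₂ - p₁) r₁ (F^[N] y)
  rw [← hr] at hkm
  refine ⟨k + N, by omega, ?_⟩
  have hmem : F^[k] (F^[N] y) + m ∈ Metric.ball z ε := by
    rw [Real.ball_eq_Ioo] at hr₁ hr₂ ⊢
    exact ordConnected_Ioo.uIcc_subset hr₁ hr₂ hkm
  have := hball hmem
  rw [mem_preimage] at this
  rw [iterate_coe_eq hF, Function.iterate_add_apply, ← AddCircle.coe_add_int _ m]
  exact this

theorem iterate_ne_self_of_irrational
    (hF : ∀ x : ℝ, f (x : AddCircle (1:ℝ)) = ((F x : ℝ) : AddCircle (1:ℝ)))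
    (hτ : Irrational F.translationNumber) {n : ℕ} (hn : 0 < n) (x : AddCircle (1:ℝ)) :
    f^[n] x ≠ x := by
  induction x using QuotientAddGroup.induction_on with | H x => ?_
  intro h
  rw [iterate_coe_eq hF] at h
  obtain ⟨m, hm⟩ := AddCircle.exists_eq_add_int_of_coe_eq h
  rw [← CircleDeg1Lift.coe_pow] at hm
  rw [F.translationNumber_of_map_pow_eq_add_int hm hn] at hτ
  exact hτ ⟨(m : ℚ) / n, by push_cast; rfl⟩

end Lift

/-- A non-empty set mapped into itself by a map without periodic points is infinite. -/
theorem Set.MapsTo.infinite_of_iterate_ne {α : Type*} {f : α → α} {s : Set α}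
    (h : MapsTo f s s) (hs : s.Nonempty) (hper : ∀ n : ℕ, 0 < n → ∀ x, f^[n] x ≠ x) :
    s.Infinite := by
  obtain ⟨x, hx⟩ := hs
  refine infinite_of_injective_forall_mem (f := fun n : ℕ => f^[n] x) ?_
    fun n => h.iterate n hx
  refine Function.Injective.of_lt_imp_ne fun m n hmn he => hper (n - m) (by omega) (f^[m] x) ?_
  rw [← Function.iterate_add_apply, Nat.sub_add_cancel hmn.le]
  exact he.symm

theorem isClosed_omegaLimitSet (f : AddCircle (1:ℝ) → AddCircle (1:ℝ)) (x : AddCircle (1:ℝ)) :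
    IsClosed (omegaLimitSet f x) :=
  isClosed_setOfPred_clusterPt

theorem omegaLimitSet_nonempty (f : AddCircle (1:ℝ) → AddCircle (1:ℝ)) (x : AddCircle (1:ℝ)) :
    (omegaLimitSet f x).Nonempty :=
  have : Fact ((0:ℝ) < 1) := ⟨one_pos⟩
  exists_clusterPt_of_compactSpace _

theorem image_omegaLimitSet {f : AddCircle (1:ℝ) → AddCircle (1:ℝ)} (hf : Continuous f)
    (x : AddCircle (1:ℝ)) : f '' omegaLimitSet f x = omegaLimitSet f x := by
  have : Fact ((0:ℝ) < 1) := ⟨one_pos⟩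
  apply Subset.antisymm
  · rintro _ ⟨z, hz, rfl⟩
    have h : MapClusterPt (f z) atTop (f ∘ fun n : ℕ => f^[n] x) :=
      MapClusterPt.continuousAt_comp hf.continuousAt hz
    refine MapClusterPt.of_comp (tendsto_add_atTop_nat 1) (h.congrFun ?_)
    exact Eventually.of_forall fun n => (Function.iterate_succ_apply' f n x).symm
  · intro z hz
    obtain ⟨U, hU, hUz⟩ := mapClusterPt_iff_ultrafilter.1 hz
    obtain ⟨w, -, hw⟩ := isCompact_univ.ultrafilter_le_nhds
      (U.map fun n : ℕ => f^[n - 1] x) (by simp)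
    have hUw : Tendsto (fun n : ℕ => f^[n - 1] x) U (𝓝 w) := hw
    refine ⟨w, ?_, ?_⟩
    · exact MapClusterPt.of_comp (φ := fun n : ℕ => n - 1) (p := U)
        ((tendsto_sub_atTop_nat 1).mono_left hU) (hUw.mapClusterPt)
    · refine tendsto_nhds_unique (((hf.tendsto w).comp hUw).congr' ?_) hUz
      filter_upwards [hU (eventually_gt_atTop 0)] with n hn
      rw [Function.comp_apply, ← Function.iterate_succ_apply' f, Nat.succ_eq_add_one,
        Nat.sub_add_cancel hn]

/-- A smooth degree-one circle map that is constant on `[1/2, 1]`. -/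
noncomputable def smoothStaircase : CircleDeg1Lift where
  toFun x := ⌊x⌋ + Real.smoothTransition (2 * Int.fract x)
  monotone' x y hxy := by
    rcases (Int.floor_mono hxy).eq_or_lt with h | h
    · have hfr : Int.fract x ≤ Int.fract y := by
        rw [Int.fract, Int.fract, h]
        linarith
      dsimp only
      rw [h]
      gcongr
      exact Real.smoothTransition.monotone (by linarith)
    · have h1 : (⌊x⌋ : ℝ) + 1 ≤ ⌊y⌋ := by exact_mod_cast h
      have h2 := Real.smoothTransition.le_one (2 * Int.fract x)
      have h3 := Real.smoothTransition.nonneg (2 * Int.fract y)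
      dsimp only
      linarith
  map_add_one' x := by
    simp only [Int.floor_add_one, Int.fract_add_one]
    push_cast
    ring

theorem smoothStaircase_apply (x : ℝ) :
    smoothStaircase x = ⌊x⌋ + Real.smoothTransition (2 * Int.fract x) := rfl

theorem smoothStaircase_eq {n : ℤ} {x : ℝ} (hx : x ∈ Ioo (n - 1 / 2 : ℝ) (n + 1)) :
    smoothStaircase x = n + Real.smoothTransition (2 * (x - n)) := by
  obtain ⟨hx1, hx2⟩ := hx
  rw [smoothStaircase_apply]
  rcases le_or_gt (n : ℝ) x with h | h
  · have hfl : ⌊x⌋ = n := Int.floor_eq_iff.2 ⟨h, hx2⟩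
    rw [Int.fract, hfl]
  · have hfl : ⌊x⌋ = n - 1 := Int.floor_eq_iff.2 (by push_cast; constructor <;> linarith)
    rw [Int.fract, hfl, Real.smoothTransition.one_of_one_le (by push_cast; linarith),
      Real.smoothTransition.zero_of_nonpos (by linarith)]
    push_cast
    ring

theorem contDiff_smoothStaircase : ContDiff ℝ (⊤ : ℕ∞) smoothStaircase := by
  rw [contDiff_iff_contDiffAt]
  intro x
  have hmem : Ioo (⌊x⌋ - 1 / 2 : ℝ) (⌊x⌋ + 1) ∈ 𝓝 x :=
    Ioo_mem_nhds (by linarith [Int.floor_le x]) (Int.lt_floor_add_one x)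
  have hsmooth : ContDiff ℝ (⊤ : ℕ∞)
      fun y : ℝ => (⌊x⌋ : ℝ) + Real.smoothTransition (2 * (y - ⌊x⌋)) :=
    contDiff_const.add (Real.smoothTransition.contDiff.comp
      (contDiff_const.mul (contDiff_id.sub contDiff_const)))
  refine hsmooth.contDiffAt.congr_of_eventuallyEq ?_
  filter_upwards [hmem] with y hy
  exact smoothStaircase_eq hy

theorem smoothStaircase_eq_one {x : ℝ} (hx : x ∈ Ioo (1 / 2 : ℝ) 1) : smoothStaircase x = 1 := by
  have h := smoothStaircase_eq (n := 0) (x := x)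
    (by push_cast; constructor <;> linarith [hx.1, hx.2])
  rw [h, Real.smoothTransition.one_of_one_le (by push_cast; linarith [hx.1])]
  simp

/-- Every real number is the translation number of a translate of `smoothStaircase`. -/
theorem exists_translationNumber_translate_mul_smoothStaircase (ρ : ℝ) :
    ∃ t : ℝ, (CircleDeg1Lift.translate (Multiplicative.ofAdd t) *
      smoothStaircase).translationNumber = ρ := by
  set g : ℝ → CircleDeg1Lift := fun t =>
    CircleDeg1Lift.translate (Multiplicative.ofAdd t) * smoothStaircase
  have hcont : Continuous fun t => (g t).translationNumber :=
    CircleDeg1Lift.continuous_translationNumber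
      (continuous_fst.add (contDiff_smoothStaircase.continuous.comp continuous_snd))
  have hdist : ∀ t, |t + smoothStaircase 0 - (g t).translationNumber| ≤ 1 := fun t =>
    (g t).dist_map_zero_translationNumber_le
  refine mem_range_of_exists_le_of_exists_ge hcont
    ⟨ρ - 1 - smoothStaircase 0, ?_⟩ ⟨ρ + 1 - smoothStaircase 0, ?_⟩
  · have := abs_le.1 (hdist (ρ - 1 - smoothStaircase 0))
    linarith [this.1]
  · have := abs_le.1 (hdist (ρ + 1 - smoothStaircase 0))
    linarith [this.2]

/-- For every irrational `ρ ∈ [0,1)` there exist a `C^∞`,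
non-decreasing, degree-one circle map `f` with rotation number `ρ`, constant on an arc
`U` of positive length, an arc `I` of positive length, and a non-empty closed set `Q`
with `f(Q) = Q`, such that (i) `ω(x) = Q` for every `x ∈ I`, (ii) `Q` is infinite, and
(iii) no proper closed subset `Q' ⊊ Q` attracts all of `I`. Thus `Q` is an attractor
whose basin contains an interval. -/
theorem exists_smooth_circle_map_with_infinite_attractor
    (ρ : ℝ) (hρmem : ρ ∈ Set.Ico (0:ℝ) 1) (hρirr : Irrational ρ) :
    ∃ (F : ℝ → ℝ) (f : AddCircle (1:ℝ) → AddCircle (1:ℝ)) (a b c d : ℝ)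
      (Q : Set (AddCircle (1:ℝ))),
      -- `f` is a `C^∞`, non-decreasing, degree-one circle map with lift `F`
      ContDiff ℝ (⊤ : ℕ∞) F ∧ Monotone F ∧ (∀ x : ℝ, F (x + 1) = F x + 1) ∧
      (∀ x : ℝ, f (x : AddCircle (1:ℝ)) = ((F x : ℝ) : AddCircle (1:ℝ))) ∧
      -- with rotation number `ρ`
      (∀ x : ℝ, Tendsto (fun n : ℕ => F^[n] x / n) atTop (𝓝 ρ)) ∧
      -- constant on the arc `U = π(a,b)` of positive length
      a < b ∧ (∀ x ∈ Set.Ioo a b, ∀ y ∈ Set.Ioo a b, F x = F y) ∧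
      -- `I = π(c,d)` is an arc of positive length
      c < d ∧
      -- `Q` is a non-empty closed invariant set
      Q.Nonempty ∧ IsClosed Q ∧ f '' Q = Q ∧
      -- (i) every point of `I` has ω-limit set exactly `Q`
      (∀ x ∈ (fun r : ℝ => (r : AddCircle (1:ℝ))) '' Set.Ioo c d,
        omegaLimitSet f x = Q) ∧
      -- (ii) `Q` is infinite (not a periodic orbit)
      Q.Infinite ∧
      -- (iii) no strictly smaller closed subset attracts all of `I`
      (∀ Q' : Set (AddCircle (1:ℝ)), IsClosed Q' → Q' ⊂ Q →
        ¬ ∀ x ∈ (fun r : ℝ => (r : AddCircle (1:ℝ))) '' Set.Ioo c d,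
            omegaLimitSet f x ⊆ Q') := by
  obtain ⟨t, ht⟩ := exists_translationNumber_translate_mul_smoothStaircase ρ
  set F : CircleDeg1Lift :=
    CircleDeg1Lift.translate (Multiplicative.ofAdd t) * smoothStaircase with hFdef
  have hFx : ∀ x, F x = t + smoothStaircase x := fun x => rfl
  have hsmooth : ContDiff ℝ (⊤ : ℕ∞) F := contDiff_const.add contDiff_smoothStaircase
  have hper : Function.Periodic (fun x : ℝ => ((F x : ℝ) : AddCircle (1:ℝ))) 1 := fun x => by
    dsimp only
    rw [F.map_add_one]
    exact_mod_cast AddCircle.coe_add_int (F x) 1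
  set f : AddCircle (1:ℝ) → AddCircle (1:ℝ) := hper.lift
  have hlift : ∀ x : ℝ, f (x : AddCircle (1:ℝ)) = ((F x : ℝ) : AddCircle (1:ℝ)) := fun x => rfl
  have hf : Continuous f :=
    continuous_coinduced_dom.2 ((AddCircle.continuous_mk' (1:ℝ)).comp hsmooth.continuous)
  have hτ : Irrational F.translationNumber := ht ▸ hρirr
  have hω : ∀ x, omegaLimitSet f x = omegaLimitSet f 0 := fun x =>
    Subset.antisymm (omegaLimitSet_subset_of_irrational hlift hτ x 0)
      (omegaLimitSet_subset_of_irrational hlift hτ 0 x)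
  have himage := image_omegaLimitSet hf 0
  refine ⟨F, f, 1 / 2, 1, 0, 1, omegaLimitSet f 0, hsmooth, F.monotone, F.map_add_one, hlift,
    fun x => ht ▸ F.tendsto_iterate_div x, by norm_num, ?_, one_pos, omegaLimitSet_nonempty f 0,
    isClosed_omegaLimitSet f 0, himage, fun x _ => hω x, ?_, ?_⟩
  · intro x hx y hy
    rw [hFx, hFx, smoothStaircase_eq_one hx, smoothStaircase_eq_one hy]
  · exact (mapsTo_iff_image_subset.2 himage.subset).infinite_of_iterate_ne
      (omegaLimitSet_nonempty f 0) fun n hn x => iterate_ne_self_of_irrational hlift hτ hn x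
  · intro Q' _ hQ' h
    have hsub := h _ ⟨1 / 2, by norm_num, rfl⟩
    rw [hω] at hsub
    exact hQ'.not_subset hsub
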